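/- Let T be a directed tree. The recursively defined relation ≺ on V(T) is well-defined (independent of the chosen ⪯-nondecreasing listings of children), asymmetric and transitive, and for all v,w ∈ V(T): neither v ≺ w nor w ≺ v holds if and only if T_v ≅ T_w. Consequently, the relation ⪯ defined by v ⪯ w iff not w ≺ v is a total preorder on V(T), and v ⪯ w together with w ⪯ v implies T_v ≅ T_w. -/

import Mathlib

/-- A (finite) directed tree: a finite directed graph with a designated root
such that every vertex is reachable from the root by exactly one directed path. -/
structure DirectedTree (V : Type) [Fintype V] where
  E : V → V → Prop
  root : V
  unique_path : ∀ v : V, ∃! l : List V,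
    l.Chain' E ∧ l.head? = some root ∧ l.getLast? = some v

namespace DirectedTree

variable {V : Type} [Fintype V]

/-- The set of vertices of the subtree `T_v` rooted at `v`. -/
def descend (T : DirectedTree V) (v : V) : Set V :=
  {u | ∃ l : List V, l.Chain' T.E ∧ l.head? = some v ∧ l.getLast? = some u}

/-- `size v := |V(T_v)|`. -/
noncomputable def size (T : DirectedTree V) (v : V) : ℕ := (T.descend v).ncard

/-- `#ₛ(v)`: the number of children of `v` of size `s`. -/
noncomputable def numCh (T : DirectedTree V) (s : ℕ) (v : V) : ℕ :=
  Nat.card {w : V // T.E v w ∧ T.size w = s}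

/-- `T_v ≅ T_w`: rooted-tree isomorphism of the subtrees rooted at `v` and `w`. -/
def SubtreeIso (T : DirectedTree V) (v w : V) : Prop :=
  ∃ f : T.descend v ≃ T.descend w,
    (∀ a : T.descend v, (a : V) = v → ((f a : V) = w)) ∧
    (∀ a b : T.descend v, T.E a b ↔ T.E (f a) (f b))

/-- `π(v) < π(w)` lexicographically, where `π(v) = (size v, #₁(v), …, #_{size v − 1}(v))`. -/
def ProfLt (T : DirectedTree V) (v w : V) : Prop :=
  T.size v < T.size w ∨
    (T.size v = T.size w ∧ ∃ s, 1 ≤ s ∧ s < T.size v ∧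
      T.numCh s v < T.numCh s w ∧
      ∀ s', 1 ≤ s' → s' < s → T.numCh s' v = T.numCh s' w)

/-- `π(v) = π(w)`. -/
def ProfEq (T : DirectedTree V) (v w : V) : Prop :=
  T.size v = T.size w ∧ ∀ s, 1 ≤ s → s < T.size v → T.numCh s v = T.numCh s w

/-- An `R`-nondecreasing listing of the children of `v`: a duplicate-free list
containing exactly the children of `v` in which no element is `R`-below its
predecessor. -/
def Listing (T : DirectedTree V) (R : V → V → Prop) (v : V) (l : List V) : Prop :=
  l.Nodup ∧ (∀ u : V, u ∈ l ↔ T.E v u) ∧ l.Chain' (fun a b => ¬ R b a)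

/-- `R` satisfies the recursive definition of the order `≺` on `V(T)`:
`v ≺ w` iff `π(v) < π(w)` lexicographically, or `π(v) = π(w)` and, listing the
children of `v` and of `w` in `≺`-nondecreasing order, there is a position `i`
with `v_i ≺ w_i` such that at every earlier position the children are
incomparable. -/
def IsTreeOrd (T : DirectedTree V) (R : V → V → Prop) : Prop :=
  ∀ v w : V, R v w ↔
    (ProfLt T v w ∨
      (ProfEq T v w ∧ ∃ lv lw : List V, Listing T R v lv ∧ Listing T R w lw ∧
        ∃ i : ℕ, ∃ hiv : i < lv.length, ∃ hiw : i < lw.length,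
          R (lv.get ⟨i, hiv⟩) (lw.get ⟨i, hiw⟩) ∧
          ∀ j : ℕ, ∀ hjv : j < lv.length, ∀ hjw : j < lw.length, j < i →
            ¬ R (lv.get ⟨j, hjv⟩) (lw.get ⟨j, hjw⟩) ∧
            ¬ R (lw.get ⟨j, hjw⟩) (lv.get ⟨j, hjv⟩)))

end DirectedTree

namespace DirectedTree

variable {V : Type} [Fintype V] (T : DirectedTree V)

/-! ### Structure of the descendant relation -/

lemma mem_descend {u v : V} : u ∈ T.descend v ↔ Relation.ReflTransGen T.E v u := by
  constructor
  · rintro ⟨l, hc, hh, hl⟩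
    have hne : l ≠ [] := by rintro rfl; simp at hh
    have := List.relationReflTransGen_of_exists_isChain l hc hne
    rw [List.head?_eq_some_head hne] at hh
    rw [List.getLast?_eq_some_getLast hne] at hl
    simpa [Option.some.inj hh, Option.some.inj hl] using this
  · intro h
    obtain ⟨l, hne, hc, hh, hl⟩ := List.exists_isChain_ne_nil_of_relationReflTransGen h
    exact ⟨l, hc, by rw [List.head?_eq_some_head hne, hh],
      by rw [List.getLast?_eq_some_getLast hne, hl]⟩

lemma self_mem_descend (v : V) : v ∈ T.descend v := T.mem_descend.2 .refl

lemma path_append {a b u : V} {p l : List V} (hp : p.IsChain T.E)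
    (hp₁ : p.head? = some T.root) (hp₂ : p.getLast? = some a) (hl : l.IsChain T.E)
    (hl₁ : l.head? = some b) (hl₂ : l.getLast? = some u) (hab : T.E a b) :
    (p ++ l).IsChain T.E ∧ (p ++ l).head? = some T.root ∧ (p ++ l).getLast? = some u := by
  refine ⟨List.isChain_append.2 ⟨hp, hl, ?_⟩, ?_, ?_⟩
  · rintro x hx y hy
    simp_all
  · simp [List.head?_append, hp₁]
  · simp [List.getLast?_append, hl₂]

lemma parent_unique {a b u : V} (ha : T.E a u) (hb : T.E b u) : a = b := by
  obtain ⟨p, ⟨hp, hp₁, hp₂⟩, -⟩ := T.unique_path a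
  obtain ⟨q, ⟨hq, hq₁, hq₂⟩, -⟩ := T.unique_path b
  have h := (T.unique_path u).unique
    (T.path_append hp hp₁ hp₂ (.singleton u) rfl rfl ha)
    (T.path_append hq hq₁ hq₂ (.singleton u) rfl rfl hb)
  rw [List.append_cancel_right h] at hp₂
  exact Option.some.inj (hp₂.symm.trans hq₂)

lemma not_reflTransGen_of_edge {a b : V} (h : T.E a b) : ¬ Relation.ReflTransGen T.E b a := by
  intro hba
  obtain ⟨l, hl, hl₁, hl₂⟩ := T.mem_descend.2 hba
  obtain ⟨p, ⟨hp, hp₁, hp₂⟩, -⟩ := T.unique_path a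
  have h := (T.unique_path a).unique (T.path_append hp hp₁ hp₂ hl hl₁ hl₂ h) ⟨hp, hp₁, hp₂⟩
  rw [List.append_right_eq_self] at h
  simp [h] at hl₁

lemma not_edge_of_mem_descend {v u : V} (hu : u ∈ T.descend v) : ¬ T.E u v := fun h =>
  T.not_reflTransGen_of_edge h (T.mem_descend.1 hu)

lemma mem_descend_of_edge {v a b : V} (ha : a ∈ T.descend v) (h : T.E a b) :
    b ∈ T.descend v :=
  T.mem_descend.2 ((T.mem_descend.1 ha).tail h)

lemma descend_subset {v a : V} (ha : a ∈ T.descend v) : T.descend a ⊆ T.descend v :=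
  fun _ hu => T.mem_descend.2 ((T.mem_descend.1 ha).trans (T.mem_descend.1 hu))

lemma child_mem_descend {v a : V} (h : T.E v a) : a ∈ T.descend v :=
  T.mem_descend_of_edge (T.self_mem_descend v) h

lemma self_notMem_descend_child {v a : V} (h : T.E v a) : v ∉ T.descend a := fun hv =>
  T.not_reflTransGen_of_edge h (T.mem_descend.1 hv)

lemma eq_or_exists_child {v u : V} (hu : u ∈ T.descend v) :
    v = u ∨ ∃ a, T.E v a ∧ u ∈ T.descend a := by
  rcases (T.mem_descend.1 hu).cases_head with h | ⟨a, ha, h⟩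
  · exact .inl h
  · exact .inr ⟨a, ha, T.mem_descend.2 h⟩

lemma child_unique {v a b u : V} (ha : T.E v a) (hb : T.E v b) (hua : u ∈ T.descend a)
    (hub : u ∈ T.descend b) : a = b := by
  have aux : ∀ {a b : V}, T.E v a → T.E v b → b ∈ T.descend a → a = b := by
    intro a b ha hb hab
    rcases (T.mem_descend.1 hab).cases_tail with h | ⟨c, hc, hcb⟩
    · exact h.symm
    · rw [← T.parent_unique hb hcb] at hc
      exact (T.not_reflTransGen_of_edge ha hc).elim
  have hU : Relator.RightUnique (Function.swap T.E) := fun _ _ _ h h' => T.parent_unique h h'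
  rcases Relation.ReflTransGen.total_of_right_unique hU
    (T.mem_descend.1 hua).swap (T.mem_descend.1 hub).swap with h | h
  · exact (aux hb ha (T.mem_descend.2 h.swap)).symm
  · exact aux ha hb (T.mem_descend.2 h.swap)

lemma size_pos (v : V) : 0 < T.size v :=
  (Set.ncard_pos (Set.toFinite _)).2 ⟨v, T.self_mem_descend v⟩

lemma size_child_lt {v a : V} (h : T.E v a) : T.size a < T.size v :=
  Set.ncard_lt_ncard ((Set.ssubset_iff_of_subset (T.descend_subset (T.child_mem_descend h))).2
    ⟨v, T.self_mem_descend v, T.self_notMem_descend_child h⟩) (Set.toFinite _)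

lemma size_le_card (v : V) : T.size v ≤ Fintype.card V := by
  rw [← Nat.card_eq_fintype_card, ← Set.ncard_univ]
  exact Set.ncard_le_ncard (Set.subset_univ _) (Set.toFinite _)

/-! ### Isomorphisms of subtrees -/

/-- `f` restricts to a rooted-tree isomorphism from `T_v` to `T_w`. -/
structure IsIsoOn (f : V → V) (v w : V) : Prop where
  bijOn : Set.BijOn f (T.descend v) (T.descend w)
  map_root : f v = w
  edge_iff : ∀ a ∈ T.descend v, ∀ b ∈ T.descend v, T.E a b ↔ T.E (f a) (f b)

lemma subtreeIso_iff {v w : V} : T.SubtreeIso v w ↔ ∃ f, T.IsIsoOn f v w := by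
  classical
  constructor
  · rintro ⟨f, hr, he⟩
    have hf : ∀ u (hu : u ∈ T.descend v),
        (if h : u ∈ T.descend v then (f ⟨u, h⟩ : V) else u) = f ⟨u, hu⟩ := fun u hu => dif_pos hu
    refine ⟨fun u => if h : u ∈ T.descend v then f ⟨u, h⟩ else u, ⟨?_, ?_, ?_⟩, ?_, ?_⟩
    · intro u hu
      simp only [hf u hu]
      exact (f ⟨u, hu⟩).2
    · intro a ha b hb hab
      simp only [hf a ha, hf b hb] at hab
      exact congrArg Subtype.val (f.injective (Subtype.ext hab))
    · intro u hu
      obtain ⟨⟨x, hx⟩, hxu⟩ := f.surjective ⟨u, hu⟩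
      exact ⟨x, hx, (hf x hx).trans (congrArg Subtype.val hxu)⟩
    · simp only [hf v (T.self_mem_descend v)]
      exact hr _ rfl
    · intro a ha b hb
      simp only [hf a ha, hf b hb]
      exact he ⟨a, ha⟩ ⟨b, hb⟩
  · rintro ⟨f, hf⟩
    refine ⟨hf.bijOn.equiv f, ?_, fun a b => hf.edge_iff a a.2 b b.2⟩
    intro a ha
    exact (congrArg f ha).trans hf.map_root

variable {T}

namespace IsIsoOn

variable {f : V → V} {v w : V}

lemma image_descend (hf : T.IsIsoOn f v w) {a : V} (ha : a ∈ T.descend v) :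
    f '' T.descend a = T.descend (f a) := by
  ext u
  constructor
  · rintro ⟨x, hx, rfl⟩
    have hx' := T.mem_descend.1 hx
    clear hx
    induction hx' with
    | refl => exact T.self_mem_descend _
    | @tail b c hb hbc ih =>
      have hb' := T.descend_subset ha (T.mem_descend.2 hb)
      exact T.mem_descend_of_edge ih
        ((hf.edge_iff _ hb' _ (T.mem_descend_of_edge hb' hbc)).1 hbc)
  · intro hu
    have hu' := T.mem_descend.1 hu
    clear hu
    induction hu' with
    | refl => exact ⟨a, T.self_mem_descend a, rfl⟩
    | @tail b c hb hbc ih =>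
      obtain ⟨x, hx, rfl⟩ := ih
      have hc := T.mem_descend_of_edge (hf.bijOn.mapsTo (T.descend_subset ha hx)) hbc
      obtain ⟨y, hy, rfl⟩ := hf.bijOn.surjOn hc
      exact ⟨y, T.mem_descend_of_edge hx
        ((hf.edge_iff _ (T.descend_subset ha hx) _ hy).2 hbc), rfl⟩

lemma restrict (hf : T.IsIsoOn f v w) {a : V} (ha : a ∈ T.descend v) :
    T.IsIsoOn f a (f a) where
  bijOn := by
    rw [← hf.image_descend ha]
    exact (hf.bijOn.injOn.mono (T.descend_subset ha)).bijOn_image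
  map_root := rfl
  edge_iff b hb c hc := hf.edge_iff b (T.descend_subset ha hb) c (T.descend_subset ha hc)

lemma size_eq (hf : T.IsIsoOn f v w) : T.size v = T.size w := by
  rw [size, size, ← hf.bijOn.image_eq, hf.bijOn.injOn.ncard_image]

lemma edge_map (hf : T.IsIsoOn f v w) {a : V} (ha : T.E v a) : T.E w (f a) := by
  have := (hf.edge_iff v (T.self_mem_descend v) a (T.child_mem_descend ha)).1 ha
  rwa [hf.map_root] at this

lemma exists_child (hf : T.IsIsoOn f v w) {b : V} (hb : T.E w b) : ∃ a, T.E v a ∧ f a = b := by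
  obtain ⟨a, ha, rfl⟩ := hf.bijOn.surjOn (T.child_mem_descend hb)
  refine ⟨a, (hf.edge_iff v (T.self_mem_descend v) a ha).2 ?_, rfl⟩
  rwa [hf.map_root]

lemma injOn_children (hf : T.IsIsoOn f v w) : Set.InjOn f {a | T.E v a} :=
  hf.bijOn.injOn.mono fun _ h => T.child_mem_descend h

lemma numCh_eq (hf : T.IsIsoOn f v w) (s : ℕ) : T.numCh s v = T.numCh s w := by
  have himg : f '' {a | T.E v a ∧ T.size a = s} = {b | T.E w b ∧ T.size b = s} := by
    ext b
    constructor
    · rintro ⟨a, ⟨ha, rfl⟩, rfl⟩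
      exact ⟨hf.edge_map ha, (hf.restrict (T.child_mem_descend ha)).size_eq.symm⟩
    · rintro ⟨hb, rfl⟩
      obtain ⟨a, ha, rfl⟩ := hf.exists_child hb
      exact ⟨a, ⟨ha, (hf.restrict (T.child_mem_descend ha)).size_eq⟩, rfl⟩
  change Set.ncard {a | T.E v a ∧ T.size a = s} = Set.ncard {b | T.E w b ∧ T.size b = s}
  rw [← himg, (hf.injOn_children.mono fun _ h => h.1).ncard_image]

end IsIsoOn

lemma exists_isIsoOn_of_children {v w : V} (e : {a // T.E v a} ≃ {b // T.E w b})
    (he : ∀ a : {a // T.E v a}, ∃ f, T.IsIsoOn f a (e a)) : ∃ f, T.IsIsoOn f v w := by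
  classical
  choose g hg using he
  let F : V → V := fun u =>
    if h : ∃ a : {a // T.E v a}, u ∈ T.descend a then g h.choose u else w
  have hF : ∀ (a : {a // T.E v a}) (u), u ∈ T.descend a → F u = g a u := by
    intro a u hu
    have h : ∃ a : {a // T.E v a}, u ∈ T.descend a := ⟨a, hu⟩
    have : h.choose = a := Subtype.ext (T.child_unique h.choose.2 a.2 h.choose_spec hu)
    simp only [F, dif_pos h, this]
  have hFv : F v = w := dif_neg fun ⟨a, ha⟩ => T.self_notMem_descend_child a.2 ha
  clear_value F
  have hmaps : ∀ (a : {a // T.E v a}) (u), u ∈ T.descend a → F u ∈ T.descend (e a) :=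
    fun a u hu => hF a u hu ▸ (hg a).bijOn.mapsTo hu
  have hcases : ∀ u ∈ T.descend v, v = u ∨ ∃ a : {a // T.E v a}, u ∈ T.descend a := by
    intro u hu
    rcases T.eq_or_exists_child hu with h | ⟨a, ha, h⟩
    · exact .inl h
    · exact .inr ⟨⟨a, ha⟩, h⟩
  have hsame : ∀ (a b : {a // T.E v a}) (x), x ∈ T.descend (e a) → x ∈ T.descend (e b) →
      a = b := fun a b x ha hb =>
    e.injective (Subtype.ext (T.child_unique (e a).2 (e b).2 ha hb))
  have hne : ∀ (a : {a // T.E v a}) (u), u ∈ T.descend a → F u ≠ w := by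
    intro a u hu h
    exact T.self_notMem_descend_child (e a).2 (h ▸ hmaps a u hu)
  refine ⟨F, ⟨?_, ?_, ?_⟩, hFv, ?_⟩
  · intro u hu
    rcases hcases u hu with rfl | ⟨a, ha⟩
    · rw [hFv]; exact T.self_mem_descend w
    · exact T.descend_subset (T.child_mem_descend (e a).2) (hmaps a u ha)
  · intro x hx y hy hxy
    rcases hcases x hx with rfl | ⟨a, ha⟩ <;> rcases hcases y hy with rfl | ⟨b, hb⟩
    · rfl
    · exact (hne b y hb (hxy ▸ hFv)).elim
    · exact (hne a x ha (hxy.trans hFv)).elim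
    · obtain rfl : a = b := hsame a b _ (hmaps a x ha) (hxy ▸ hmaps b y hb)
      rw [hF a x ha, hF a y hb] at hxy
      exact (hg a).bijOn.injOn ha hb hxy
  · intro u hu
    rcases T.eq_or_exists_child hu with rfl | ⟨b, hb, hub⟩
    · exact ⟨v, T.self_mem_descend v, hFv⟩
    · obtain ⟨a, ha⟩ := e.surjective ⟨b, hb⟩
      have hub' : u ∈ T.descend (e a) := by rwa [ha]
      obtain ⟨x, hx, rfl⟩ := (hg a).bijOn.surjOn hub'
      exact ⟨x, T.descend_subset (T.child_mem_descend a.2) hx, hF a x hx⟩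
  · intro x hx y hy
    rcases hcases y hy with rfl | ⟨b, hb⟩
    · refine iff_of_false (T.not_edge_of_mem_descend hx) ?_
      rw [hFv]
      refine T.not_edge_of_mem_descend ?_
      rcases hcases x hx with rfl | ⟨a, ha⟩
      · rw [hFv]; exact T.self_mem_descend w
      · exact T.descend_subset (T.child_mem_descend (e a).2) (hmaps a x ha)
    rcases hcases x hx with rfl | ⟨a, ha⟩
    · rw [hFv]
      constructor
      · intro h
        obtain rfl : y = b := T.child_unique h b.2 (T.self_mem_descend y) hb
        rw [hF b _ hb, (hg b).map_root]
        exact (e b).2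
      · intro h
        have h1 : F y = e b :=
          T.child_unique h (e b).2 (T.self_mem_descend _) (hmaps b y hb)
        rw [hF b y hb, ← (hg b).map_root] at h1
        rw [(hg b).bijOn.injOn hb (T.self_mem_descend _) h1]
        exact b.2
    · constructor
      · intro h
        obtain rfl : a = b :=
          Subtype.ext (T.child_unique a.2 b.2 (T.mem_descend_of_edge ha h) hb)
        rw [hF a x ha, hF a y hb]
        exact ((hg a).edge_iff x ha y hb).1 h
      · intro h
        obtain rfl : a = b :=
          hsame a b _ (T.mem_descend_of_edge (hmaps a x ha) h) (hmaps b y hb)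
        rw [hF a x ha, hF a y hb] at h
        exact ((hg a).edge_iff x ha y hb).2 h

/-! ### A canonical rank function -/

variable (T)

open Classical in
/-- The children of `v`. -/
noncomputable def children (v : V) : Finset V := Finset.univ.filter (T.E v)

@[simp] lemma mem_children {v u : V} : u ∈ T.children v ↔ T.E v u := by simp [children]

/-- The sorted list of the `r`-values of the children of `v`. -/
noncomputable def childRanks (r : V → ℕ) (v : V) : List ℕ :=
  ((T.children v).val.map r).sort (· ≤ ·)

/-- The profile of `v` followed by the sorted list of `r`-values of its children. -/
noncomputable def key (r : V → ℕ) (v : V) : ℕ ×ₗ Lex (ℕ → ℕ) ×ₗ List ℕ :=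
  toLex (T.size v, toLex (toLex fun s => T.numCh s v, T.childRanks r v))

open Classical in
/-- The number of vertices whose key with respect to `r` is below that of `v`. -/
noncomputable def stepRank (r : V → ℕ) (v : V) : ℕ :=
  (Finset.univ.filter fun w => T.key r w < T.key r v).card

/-- The position of `v` in the order by keys, where keys use the ranks of the children. -/
noncomputable def rank : V → ℕ := T.stepRank^[Fintype.card V] 0

lemma stepRank_lt_iff (r : V → ℕ) (v w : V) :
    T.stepRank r v < T.stepRank r w ↔ T.key r v < T.key r w := by
  classical
  have mono : ∀ {v w}, T.key r v ≤ T.key r w → T.stepRank r v ≤ T.stepRank r w := by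
    intro v w h
    refine Finset.card_le_card fun u hu => ?_
    simp only [Finset.mem_filter, Finset.mem_univ, true_and] at hu ⊢
    exact hu.trans_le h
  constructor
  · intro h
    by_contra! h'
    exact h.not_ge (mono h')
  · intro h
    refine Finset.card_lt_card ((Finset.ssubset_iff_of_subset fun u hu => ?_).2 ⟨v, ?_, ?_⟩)
    · simp only [Finset.mem_filter, Finset.mem_univ, true_and] at hu ⊢
      exact hu.trans h
    · simpa using h
    · simp

lemma key_congr {r r' : V → ℕ} {v : V} (h : ∀ a, T.E v a → r a = r' a) :
    T.key r v = T.key r' v := by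
  have : T.childRanks r v = T.childRanks r' v := by
    unfold childRanks
    rw [Multiset.map_congr rfl fun a ha => h a (T.mem_children.1 ha)]
  rw [key, key, this]

lemma size_le_of_key_lt {r : V → ℕ} {v w : V} (h : T.key r v < T.key r w) :
    T.size v ≤ T.size w := by
  rcases Prod.Lex.toLex_lt_toLex.1 h with h | h
  · exact h.le
  · exact h.1.le

lemma stepRank_congr {r r' : V → ℕ} {n : ℕ} (h : ∀ a, T.size a ≤ n → r a = r' a) {v : V}
    (hv : T.size v ≤ n + 1) : T.stepRank r v = T.stepRank r' v := by
  classical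
  have key_eq : ∀ w, T.size w ≤ n + 1 → T.key r w = T.key r' w := fun w hw =>
    T.key_congr fun a ha => h a (by have := T.size_child_lt ha; omega)
  unfold stepRank
  congr 1
  ext w
  simp only [Finset.mem_filter, Finset.mem_univ, true_and]
  constructor <;> intro hw
  · rwa [← key_eq v hv, ← key_eq w ((T.size_le_of_key_lt hw).trans hv)]
  · rwa [key_eq v hv, key_eq w ((T.size_le_of_key_lt hw).trans hv)]

lemma iterate_stepRank (n : ℕ) : ∀ v, T.size v ≤ n →
    T.stepRank^[n + 1] 0 v = T.stepRank^[n] 0 v := by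
  induction n with
  | zero => intro v hv; exact absurd (T.size_pos v) (by omega)
  | succ n ih =>
    intro v hv
    rw [Function.iterate_succ_apply' _ (n + 1)]
    conv_rhs => rw [Function.iterate_succ_apply' _ n]
    exact T.stepRank_congr ih hv

lemma stepRank_rank : T.stepRank T.rank = T.rank := by
  ext v
  have := T.iterate_stepRank (Fintype.card V) v (T.size_le_card v)
  rwa [Function.iterate_succ_apply'] at this

lemma rank_lt_iff (v w : V) : T.rank v < T.rank w ↔ T.key T.rank v < T.key T.rank w := by
  conv_lhs => rw [← stepRank_rank]
  exact T.stepRank_lt_iff _ v w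

lemma rank_eq_iff (v w : V) : T.rank v = T.rank w ↔ T.key T.rank v = T.key T.rank w := by
  have h₁ := T.rank_lt_iff v w
  have h₂ := T.rank_lt_iff w v
  rw [eq_iff_le_not_lt, eq_iff_le_not_lt (a := T.key _ _), h₁, ← not_lt, ← not_lt, h₂]

lemma key_eq_iff {r : V → ℕ} {v w : V} : T.key r v = T.key r w ↔
    T.size v = T.size w ∧ (∀ s, T.numCh s v = T.numCh s w) ∧
      T.childRanks r v = T.childRanks r w := by
  simp [key, Prod.ext_iff, funext_iff]

lemma childRanks_eq_iff {r : V → ℕ} {v w : V} : T.childRanks r v = T.childRanks r w ↔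
    (T.children v).val.map r = (T.children w).val.map r := by
  constructor
  · intro h
    rw [← Multiset.sort_eq ((T.children v).val.map r) (· ≤ ·),
      ← Multiset.sort_eq ((T.children w).val.map r) (· ≤ ·)]
    exact congrArg _ h
  · intro h
    rw [childRanks, childRanks, h]

variable {T}

lemma IsIsoOn.rank_eq {f : V → V} {v w : V} (hf : T.IsIsoOn f v w) : T.rank v = T.rank w := by
  classical
  induction hn : T.size v using Nat.strong_induction_on generalizing v w with
  | _ n ih =>
    subst hn
    refine (T.rank_eq_iff v w).2 (T.key_eq_iff.2 ⟨hf.size_eq, hf.numCh_eq, ?_⟩)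
    have himg : T.children w = (T.children v).image f := by
      ext b
      simp only [mem_children, Finset.mem_image]
      exact ⟨hf.exists_child, fun ⟨a, ha, h⟩ => h ▸ hf.edge_map ha⟩
    have hinj : Set.InjOn f (T.children v) := by
      simpa [Set.InjOn] using hf.injOn_children
    rw [childRanks_eq_iff, himg, Finset.image_val_of_injOn hinj, Multiset.map_map]
    refine Multiset.map_congr rfl fun a ha => ?_
    have ha' : T.E v a := T.mem_children.1 ha
    exact ih _ (T.size_child_lt ha') (hf.restrict (T.child_mem_descend ha')) rfl

lemma exists_children_equiv {r : V → ℕ} {v w : V} (h : T.childRanks r v = T.childRanks r w) :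
    ∃ e : {a // T.E v a} ≃ {b // T.E w b}, ∀ a : {a // T.E v a}, r (e a) = r a := by
  classical
  have hcard : ∀ (c : ℕ) (v : V), Fintype.card {a : {a // T.E v a} // r a = c} =
      ((T.children v).val.map r).count c := by
    intro c v
    rw [Multiset.count_map,
      Fintype.card_congr (Equiv.subtypeSubtypeEquivSubtypeInter (T.E v) fun a => r a = c),
      Fintype.card_subtype, children, ← Finset.filter_val, Finset.filter_filter]
    simp [eq_comm, Finset.card]
  have e : ∀ c, {a : {a // T.E v a} // r a = c} ≃ {b : {b // T.E w b} // r b = c} := fun c =>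
    Fintype.equivOfCardEq (by rw [hcard, hcard, T.childRanks_eq_iff.1 h])
  exact ⟨Equiv.ofFiberEquiv e, fun a => Equiv.ofFiberEquiv_map e a⟩

lemma exists_isIsoOn_of_rank_eq {v w : V} (h : T.rank v = T.rank w) :
    ∃ f, T.IsIsoOn f v w := by
  induction hn : T.size v using Nat.strong_induction_on generalizing v w with
  | _ n ih =>
    subst hn
    obtain ⟨e, he⟩ := exists_children_equiv (T.key_eq_iff.1 ((T.rank_eq_iff v w).1 h)).2.2
    exact exists_isIsoOn_of_children e fun a => ih _ (T.size_child_lt a.2) (he a).symm rfl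

lemma subtreeIso_iff_rank_eq {v w : V} : T.SubtreeIso v w ↔ T.rank v = T.rank w :=
  T.subtreeIso_iff.trans ⟨fun ⟨_, hf⟩ => hf.rank_eq, exists_isIsoOn_of_rank_eq⟩

/-! ### The recursive definition computes the comparison of ranks -/

lemma numCh_eq_zero {s : ℕ} {v : V} (h : s = 0 ∨ T.size v ≤ s) : T.numCh s v = 0 := by
  have : IsEmpty {w : V // T.E v w ∧ T.size w = s} := by
    refine ⟨fun ⟨w, hw, hs⟩ => ?_⟩
    have h₁ := T.size_pos w
    have h₂ := T.size_child_lt hw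
    omega
  exact Nat.card_of_isEmpty

lemma profEq_iff {v w : V} :
    T.ProfEq v w ↔ T.size v = T.size w ∧ ∀ s, T.numCh s v = T.numCh s w := by
  refine and_congr_right fun hsize => ⟨fun h s => ?_, fun h s _ _ => h s⟩
  by_cases hs : 1 ≤ s ∧ s < T.size v
  · exact h s hs.1 hs.2
  · rw [numCh_eq_zero (by omega), numCh_eq_zero (by omega)]

lemma profLt_iff {v w : V} : T.ProfLt v w ↔ T.size v < T.size w ∨ (T.size v = T.size w ∧
    toLex (fun s => T.numCh s v) < toLex fun s => T.numCh s w) := by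
  refine or_congr_right (and_congr_right fun hsize => ⟨?_, ?_⟩)
  · rintro ⟨s, -, -, hlt, heq⟩
    refine ⟨s, fun s' hs' => ?_, hlt⟩
    rcases Nat.eq_zero_or_pos s' with rfl | h0
    · exact (numCh_eq_zero (.inl rfl)).trans (numCh_eq_zero (.inl rfl)).symm
    · exact heq s' h0 hs'
  · rintro ⟨s, heq, hlt⟩
    have hs : ¬ (s = 0 ∨ T.size w ≤ s) := fun h => by
      have := numCh_eq_zero (T := T) h
      change T.numCh s v < T.numCh s w at hlt
      omega
    exact ⟨s, by omega, by omega, hlt, fun s' _ hs' => heq s' hs'⟩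

lemma key_lt_iff {r : V → ℕ} {v w : V} : T.key r v < T.key r w ↔
    T.ProfLt v w ∨ (T.ProfEq v w ∧ T.childRanks r v < T.childRanks r w) := by
  rw [key, key, Prod.Lex.toLex_lt_toLex, Prod.Lex.toLex_lt_toLex, profLt_iff, profEq_iff]
  simp only [toLex_inj, funext_iff]
  tauto

lemma map_eq_childRanks {R : V → V → Prop} {r : V → ℕ} {v : V} {l : List V}
    (hR : ∀ a b, T.E v a → T.E v b → (R a b ↔ r a < r b)) (hl : T.Listing R v l) :
    l.map r = T.childRanks r v := by
  obtain ⟨hnd, hmem, hch⟩ := hl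
  have hval : (T.children v).val = (l : Multiset V) :=
    (Multiset.Nodup.ext (T.children v).nodup (by simpa using hnd)).2 fun a => by
      simp [hmem]
  have hch' : (l.map r).IsChain (· ≤ ·) := by
    rw [List.isChain_map]
    refine List.IsChain.imp_of_mem_imp (fun a b ha hb h => ?_) hch
    rw [hR b a ((hmem b).1 hb) ((hmem a).1 ha)] at h
    exact not_lt.1 h
  refine List.Perm.eq_of_pairwise' hch'.pairwise (Multiset.pairwise_sort _ _) ?_
  rw [← Multiset.coe_eq_coe, childRanks, Multiset.sort_eq, hval, Multiset.map_coe]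

lemma exists_listing {R : V → V → Prop} {r : V → ℕ} {v : V}
    (hR : ∀ a b, T.E v a → T.E v b → (R a b ↔ r a < r b)) : ∃ l, T.Listing R v l := by
  classical
  let le : V → V → Prop := fun a b => r a ≤ r b
  have : IsTrans V le := ⟨fun _ _ _ => le_trans⟩
  have : Std.Total le := ⟨fun a b => le_total (r a) (r b)⟩
  have hmem : ∀ u, u ∈ (T.children v).toList.insertionSort le ↔ T.E v u := by simp
  refine ⟨(T.children v).toList.insertionSort le, ?_, hmem, ?_⟩
  · exact (List.perm_insertionSort le _).nodup_iff.2 (T.children v).nodup_toList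
  · refine List.IsChain.imp_of_mem_imp (fun a b ha hb h => ?_)
      (List.pairwise_insertionSort le (T.children v).toList).isChain
    rw [hR b a ((hmem b).1 hb) ((hmem a).1 ha)]
    exact not_lt.2 h

lemma childRanks_length {r : V → ℕ} (v : V) :
    (T.childRanks r v).length = (T.children v).card := by
  simp [childRanks]

lemma card_children_eq_sum (v : V) :
    (T.children v).card = ∑ s ∈ Finset.range (Fintype.card V + 1), T.numCh s v := by
  classical
  rw [Finset.card_eq_sum_card_fiberwise (f := T.size) (t := Finset.range (Fintype.card V + 1))
    fun a _ => by simpa using Nat.lt_succ_of_le (T.size_le_card a)]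
  refine Finset.sum_congr rfl fun s _ => ?_
  rw [numCh, Nat.card_eq_fintype_card, Fintype.card_subtype, children, Finset.filter_filter]

/-- The second clause in the recursive definition of `≺`. -/
def ChildrenLt (T : DirectedTree V) (R : V → V → Prop) (v w : V) : Prop :=
  ∃ lv lw : List V, Listing T R v lv ∧ Listing T R w lw ∧
    ∃ i : ℕ, ∃ hiv : i < lv.length, ∃ hiw : i < lw.length,
      R (lv.get ⟨i, hiv⟩) (lw.get ⟨i, hiw⟩) ∧
      ∀ j : ℕ, ∀ hjv : j < lv.length, ∀ hjw : j < lw.length, j < i →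
        ¬ R (lv.get ⟨j, hjv⟩) (lw.get ⟨j, hjw⟩) ∧
        ¬ R (lw.get ⟨j, hjw⟩) (lv.get ⟨j, hjv⟩)

lemma childrenLt_iff {R : V → V → Prop} {r : V → ℕ} {v w : V}
    (hR : ∀ a b, (T.E v a ∨ T.E w a) → (T.E v b ∨ T.E w b) → (R a b ↔ r a < r b))
    (hvw : T.ProfEq v w) : T.ChildrenLt R v w ↔ T.childRanks r v < T.childRanks r w := by
  have hlen : (T.childRanks r v).length = (T.childRanks r w).length := by
    simp only [childRanks_length, card_children_eq_sum, (profEq_iff.1 hvw).2]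
  have hRv : ∀ a b, T.E v a → T.E v b → (R a b ↔ r a < r b) :=
    fun a b ha hb => hR a b (.inl ha) (.inl hb)
  have hRw : ∀ a b, T.E w a → T.E w b → (R a b ↔ r a < r b) :=
    fun a b ha hb => hR a b (.inr ha) (.inr hb)
  have first_difference : ∀ lv lw : List V, T.Listing R v lv → T.Listing R w lw →
      ((∃ i : ℕ, ∃ hiv : i < lv.length, ∃ hiw : i < lw.length,
        R (lv.get ⟨i, hiv⟩) (lw.get ⟨i, hiw⟩) ∧
        ∀ j : ℕ, ∀ hjv : j < lv.length, ∀ hjw : j < lw.length, j < i →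
          ¬ R (lv.get ⟨j, hjv⟩) (lw.get ⟨j, hjw⟩) ∧
          ¬ R (lw.get ⟨j, hjw⟩) (lv.get ⟨j, hjv⟩)) ↔
        T.childRanks r v < T.childRanks r w) := by
    intro lv lw hlv hlw
    have hmv : ∀ i (h : i < lv.length), T.E v lv[i] := fun i h =>
      (hlv.2.1 _).1 (List.getElem_mem h)
    have hmw : ∀ i (h : i < lw.length), T.E w lw[i] := fun i h =>
      (hlw.2.1 _).1 (List.getElem_mem h)
    rw [List.lt_iff_exists, or_iff_right (fun h => h.2.ne hlen)]
    simp only [← map_eq_childRanks hRv hlv, ← map_eq_childRanks hRw hlw, List.length_map,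
      List.getElem_map, List.get_eq_getElem]
    refine exists_congr fun i => exists_congr fun hiv => exists_congr fun hiw => ?_
    rw [hR _ _ (.inl (hmv i hiv)) (.inr (hmw i hiw)), and_comm]
    refine and_congr_left fun _ => ⟨fun h j hj => ?_, fun h j hjv hjw hj => ?_⟩
    · have := h j (hj.trans hiv) (hj.trans hiw) hj
      rw [hR _ _ (.inl (hmv j _)) (.inr (hmw j _)), hR _ _ (.inr (hmw j _)) (.inl (hmv j _))]
        at this
      omega
    · have := h j hj
      rw [hR _ _ (.inl (hmv j _)) (.inr (hmw j _)), hR _ _ (.inr (hmw j _)) (.inl (hmv j _))]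
      omega
  constructor
  · rintro ⟨lv, lw, hlv, hlw, h⟩
    exact (first_difference lv lw hlv hlw).1 h
  · intro h
    obtain ⟨lv, hlv⟩ := exists_listing hRv
    obtain ⟨lw, hlw⟩ := exists_listing hRw
    exact ⟨lv, lw, hlv, hlw, (first_difference lv lw hlv hlw).2 h⟩

lemma profLt_or_childrenLt_iff {R : V → V → Prop} {v w : V}
    (hR : ∀ a b, T.size a + T.size b < T.size v + T.size w → (R a b ↔ T.rank a < T.rank b)) :
    (T.ProfLt v w ∨ (T.ProfEq v w ∧ T.ChildrenLt R v w)) ↔ T.rank v < T.rank w := by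
  rw [rank_lt_iff, key_lt_iff]
  refine or_congr_right (and_congr_right fun h => childrenLt_iff (fun a b ha hb => hR a b ?_) h)
  have hsize := h.1
  have ha' : T.size a < T.size v := ha.elim T.size_child_lt fun h => hsize ▸ T.size_child_lt h
  have hb' : T.size b < T.size w := hb.elim (fun h => hsize ▸ T.size_child_lt h) T.size_child_lt
  omega

lemma isTreeOrd_rank : T.IsTreeOrd fun v w => T.rank v < T.rank w := fun _ _ =>
  (profLt_or_childrenLt_iff fun _ _ _ => Iff.rfl).symm

lemma IsTreeOrd.iff_rank_lt {R : V → V → Prop} (hR : T.IsTreeOrd R) (v w : V) :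
    R v w ↔ T.rank v < T.rank w := by
  induction hn : T.size v + T.size w using Nat.strong_induction_on generalizing v w with
  | _ n ih =>
    subst hn
    exact (hR v w).trans (profLt_or_childrenLt_iff fun a b hab => ih _ hab a b rfl)

end DirectedTree

open DirectedTree

/-- The recursively defined relation `≺` on the vertices of a
directed tree is well-defined (there is a unique relation satisfying the recursive
definition, in particular it does not depend on the chosen nondecreasing listings of
children), asymmetric and transitive, and two vertices are `≺`-incomparable iff their
subtrees are isomorphic.  Consequently `⪯`, defined by `v ⪯ w` iff `¬ (w ≺ v)`, is a
total preorder, and `v ⪯ w` together with `w ⪯ v` implies `T_v ≅ T_w`. -/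
theorem tree_order_props {V : Type} [Fintype V] (T : DirectedTree V) :
    (∃! R : V → V → Prop, IsTreeOrd T R) ∧
    (∀ R : V → V → Prop, IsTreeOrd T R →
      (∀ v w, R v w → ¬ R w v) ∧
      (∀ u v w, R u v → R v w → R u w) ∧
      (∀ v w, (¬ R v w ∧ ¬ R w v) ↔ T.SubtreeIso v w) ∧
      (∀ v w, ¬ R w v ∨ ¬ R v w) ∧
      (∀ u v w, ¬ R v u → ¬ R w v → ¬ R w u) ∧
      (∀ v w, ¬ R w v → ¬ R v w → T.SubtreeIso v w)) := by
  refine ⟨⟨fun v w => T.rank v < T.rank w, isTreeOrd_rank, fun R hR => ?_⟩, fun R hR => ?_⟩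
  · ext v w
    exact hR.iff_rank_lt v w
  · simp only [hR.iff_rank_lt, subtreeIso_iff_rank_eq]
    refine ⟨?_, ?_, ?_, ?_, ?_, ?_⟩ <;> intros <;> omega
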